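/- The quantum complete intersection A is selfinjective: A is injective as a left module over itself. -/

import Mathlib

/-- The defining relations of the quantum complete intersection with `c` generators `x_i`,
exponents `a i`, and commutation matrix `q`: `x_i ^ (a i) = 0` for all `i`, and
`x_i x_j = q i j • (x_j x_i)` for `i < j`. -/
inductive QCIRel (k : Type) [Field k] (c : ℕ) (q : Fin c → Fin c → k) (a : Fin c → ℕ) :
    FreeAlgebra k (Fin c) → FreeAlgebra k (Fin c) → Prop
  | pow (i : Fin c) : QCIRel k c q a (FreeAlgebra.ι k i ^ a i) 0
  | comm (i j : Fin c) (hij : i < j) :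
      QCIRel k c q a (FreeAlgebra.ι k i * FreeAlgebra.ι k j)
        (q i j • (FreeAlgebra.ι k j * FreeAlgebra.ι k i))

/-- The quantum complete intersection `A = k⟨x_1,…,x_c⟩/(x_i^{a_i}, x_ix_j - q_{ij} x_jx_i)`. -/
abbrev QCI (k : Type) [Field k] (c : ℕ) (q : Fin c → Fin c → k) (a : Fin c → ℕ) : Type :=
  RingQuot (QCIRel k c q a)

/-- The image of the generator `x_i` in `A`. -/
noncomputable def Xgen (k : Type) [Field k] (c : ℕ) (q : Fin c → Fin c → k) (a : Fin c → ℕ)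
    (i : Fin c) : QCI k c q a :=
  RingQuot.mkAlgHom k (QCIRel k c q a) (FreeAlgebra.ι k i)


/-- A finite-dimensional algebra with a linear form whose kernel contains no nonzero left ideal
is injective as a left module over itself. -/
theorem injective_self_of_nondegenerate_form {k A : Type} [Field k] [Ring A] [Algebra k A]
    [FiniteDimensional k A] (φ : A →ₗ[k] k) (hφ : ∀ y : A, (∀ r, φ (r * y) = 0) → y = 0) :
    Module.Injective A A := by
  apply Module.Baer.injective
  intro I f
  let F : A →ₗ[k] Module.Dual k A := (LinearMap.mul k A).flip.compr₂ φ
  have hF : ∀ b r, F b r = φ (r * b) := fun _ _ => rfl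
  have hinj : Function.Injective F := by
    rw [← LinearMap.ker_eq_bot, LinearMap.ker_eq_bot']
    intro b hb
    exact hφ b fun r => by rw [← hF, hb, LinearMap.zero_apply]
  have hsurj : Function.Surjective F :=
    (LinearMap.injective_iff_surjective_of_finrank_eq_finrank
      (Subspace.dual_finrank_eq (K := k) (V := A)).symm).1 hinj
  obtain ⟨g, hg⟩ := LinearMap.exists_extend (p := I.restrictScalars k)
    (φ ∘ₗ (f.restrictScalars k : I.restrictScalars k →ₗ[k] A))
  obtain ⟨b, hb⟩ := hsurj g
  have hgI : ∀ x (hx : x ∈ I), g x = φ (f ⟨x, hx⟩) := fun x hx =>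
    LinearMap.congr_fun hg (⟨x, hx⟩ : I.restrictScalars k)
  refine ⟨LinearMap.toSpanSingleton A A b, fun x hx => ?_⟩
  rw [LinearMap.toSpanSingleton_apply, smul_eq_mul, ← sub_eq_zero]
  refine hφ _ fun r => ?_
  have h1 : φ (r * (x * b)) = φ (r * f ⟨x, hx⟩) := by
    rw [← mul_assoc, ← hF, hb, hgI (r * x) (I.mul_mem_left r hx), ← smul_eq_mul r (f _),
      ← f.map_smul]
    rfl
  rw [mul_sub, map_sub, h1, sub_self]

section QCI

variable {k : Type} [Field k] {c : ℕ} {q : Fin c → Fin c → k} {a : Fin c → ℕ}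

theorem Xgen_pow (i : Fin c) : Xgen k c q a i ^ a i = 0 := by
  rw [Xgen, ← map_pow, RingQuot.mkAlgHom_rel k (QCIRel.pow i), map_zero]

theorem Xgen_mul_of_lt {i j : Fin c} (hij : i < j) :
    Xgen k c q a i * Xgen k c q a j = q i j • (Xgen k c q a j * Xgen k c q a i) := by
  simp only [Xgen]
  rw [← map_mul, RingQuot.mkAlgHom_rel k (QCIRel.comm i j hij), map_smul, map_mul]

theorem Xgen_mul (hq1 : ∀ i, q i i = 1) (hq2 : ∀ i j, q i j * q j i = 1) (i j : Fin c) :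
    Xgen k c q a i * Xgen k c q a j = q i j • (Xgen k c q a j * Xgen k c q a i) := by
  rcases lt_trichotomy i j with h | rfl | h
  · exact Xgen_mul_of_lt h
  · rw [hq1, one_smul]
  · rw [Xgen_mul_of_lt h, smul_smul, hq2, one_smul]

/-- Reordering a word in the generators changes it by a nonzero scalar. -/
theorem exists_smul_of_perm (hq1 : ∀ i, q i i = 1) (hq2 : ∀ i j, q i j * q j i = 1)
    {l l' : List (Fin c)} (h : l.Perm l') :
    ∃ u : k, u ≠ 0 ∧ (l.map (Xgen k c q a)).prod = u • (l'.map (Xgen k c q a)).prod := by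
  induction h with
  | nil => exact ⟨1, one_ne_zero, by simp⟩
  | cons i _ ih =>
    obtain ⟨u, hu, h⟩ := ih
    exact ⟨u, hu, by simp only [List.map_cons, List.prod_cons, h, mul_smul_comm]⟩
  | swap i j l =>
    refine ⟨q j i, left_ne_zero_of_mul_eq_one (hq2 j i), ?_⟩
    simp only [List.map_cons, List.prod_cons, ← mul_assoc]
    rw [Xgen_mul hq1 hq2 j i, smul_mul_assoc]
  | trans _ _ ih₁ ih₂ =>
    obtain ⟨u, hu, h⟩ := ih₁
    obtain ⟨v, hv, h'⟩ := ih₂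
    exact ⟨u * v, mul_ne_zero hu hv, by rw [h, h', smul_smul]⟩

variable (k q a) in
/-- The monomial with the given multiset of factors, in some fixed order. -/
noncomputable def qciMonomial (s : Multiset (Fin c)) : QCI k c q a :=
  (s.toList.map (Xgen k c q a)).prod

theorem exists_prod_eq_smul_qciMonomial (hq1 : ∀ i, q i i = 1) (hq2 : ∀ i j, q i j * q j i = 1)
    {l : List (Fin c)} {s : Multiset (Fin c)} (h : (l : Multiset (Fin c)) = s) :
    ∃ u : k, u ≠ 0 ∧ (l.map (Xgen k c q a)).prod = u • qciMonomial k q a s :=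
  exists_smul_of_perm hq1 hq2 (Multiset.coe_eq_coe.1 (by rw [h, Multiset.coe_toList]))

theorem exists_qciMonomial_mul (hq1 : ∀ i, q i i = 1) (hq2 : ∀ i j, q i j * q j i = 1)
    (s t : Multiset (Fin c)) :
    ∃ u : k, u ≠ 0 ∧
      qciMonomial k q a s * qciMonomial k q a t = u • qciMonomial k q a (s + t) := by
  obtain ⟨u, hu, h⟩ := exists_prod_eq_smul_qciMonomial (a := a) hq1 hq2
    (l := s.toList ++ t.toList) (s := s + t) (by
      rw [← Multiset.coe_add, Multiset.coe_toList, Multiset.coe_toList])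
  exact ⟨u, hu, by rw [← h, List.map_append, List.prod_append, qciMonomial, qciMonomial]⟩

theorem qciMonomial_eq_zero (hq1 : ∀ i, q i i = 1) (hq2 : ∀ i j, q i j * q j i = 1)
    {s : Multiset (Fin c)} {i : Fin c} (h : a i ≤ s.count i) : qciMonomial k q a s = 0 := by
  obtain ⟨t, rfl⟩ := Multiset.le_iff_exists_add.1 (Multiset.le_count_iff_replicate_le.1 h)
  obtain ⟨u, hu, h⟩ := exists_prod_eq_smul_qciMonomial (a := a) hq1 hq2
    (l := List.replicate (a i) i ++ t.toList) (s := Multiset.replicate (a i) i + t) (by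
      rw [← Multiset.coe_add, Multiset.coe_toList, Multiset.coe_replicate])
  rw [List.map_append, List.prod_append, List.map_replicate, List.prod_replicate, Xgen_pow,
    zero_mul] at h
  exact (smul_eq_zero.1 h.symm).resolve_left hu

variable (a) in
/-- The multiset of factors of the monomial of largest degree, the socle of the algebra. -/
def qciTop : Multiset (Fin c) := ∑ i, Multiset.replicate (a i - 1) i

theorem count_qciTop (i : Fin c) : (qciTop a).count i = a i - 1 := by
  simp [qciTop, Multiset.count_sum', Multiset.count_replicate]

theorem qciMonomial_eq_zero_of_not_le (hq1 : ∀ i, q i i = 1) (hq2 : ∀ i j, q i j * q j i = 1)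
    {s : Multiset (Fin c)} (h : ¬ s ≤ qciTop a) : qciMonomial k q a s = 0 := by
  rw [Multiset.le_iff_count] at h
  push Not at h
  obtain ⟨i, hi⟩ := h
  rw [count_qciTop] at hi
  exact qciMonomial_eq_zero hq1 hq2 (i := i) (by omega)

theorem mem_span_qciMonomial (hq1 : ∀ i, q i i = 1) (hq2 : ∀ i j, q i j * q j i = 1)
    (y : QCI k c q a) :
    y ∈ Submodule.span k (qciMonomial k q a '' {s | s ≤ qciTop a}) := by
  set S := Submodule.span k (qciMonomial k q a '' {s | s ≤ qciTop a}) with hS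
  have hmon : ∀ s, qciMonomial k q a s ∈ S := fun s => by
    by_cases h : s ≤ qciTop a
    · exact Submodule.subset_span ⟨s, h, rfl⟩
    · rw [qciMonomial_eq_zero_of_not_le hq1 hq2 h]
      exact S.zero_mem
  have hone : (1 : QCI k c q a) ∈ S := by simpa [qciMonomial] using hmon 0
  have hmul : ∀ x ∈ S, ∀ z ∈ S, x * z ∈ S := fun x hx z hz => by
    have h : S * S ≤ S := by
      rw [hS, Submodule.span_mul_span, Submodule.span_le]
      rintro _ ⟨_, ⟨s, -, rfl⟩, _, ⟨t, -, rfl⟩, rfl⟩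
      obtain ⟨u, -, h⟩ := exists_qciMonomial_mul (a := a) hq1 hq2 s t
      simp only [h]
      exact S.smul_mem u (hmon _)
    exact h (Submodule.mul_mem_mul hx hz)
  obtain ⟨w, rfl⟩ := RingQuot.mkAlgHom_surjective k (QCIRel k c q a) y
  induction w using FreeAlgebra.induction with
  | grade0 r =>
    rw [AlgHom.commutes, Algebra.algebraMap_eq_smul_one]
    exact S.smul_mem r hone
  | grade1 i => simpa [qciMonomial, Xgen] using hmon {i}
  | mul x z hx hz => rw [map_mul]; exact hmul _ hx _ hz
  | add x z hx hz => rw [map_add]; exact S.add_mem hx hz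

theorem finiteDimensional_qci (hq1 : ∀ i, q i i = 1) (hq2 : ∀ i j, q i j * q j i = 1) :
    FiniteDimensional k (QCI k c q a) := by
  have hfin : {s | s ≤ qciTop a}.Finite :=
    (Multiset.finite_toSet (qciTop a).powerset).subset fun s hs => Multiset.mem_powerset.2 hs
  exact ⟨Submodule.fg_def.2 ⟨_, hfin.image _,
    Submodule.eq_top_iff'.2 (mem_span_qciMonomial hq1 hq2)⟩⟩

/-- Every nonzero left ideal contains the monomial of largest degree. -/
theorem exists_mul_eq_smul_qciTop (hq1 : ∀ i, q i i = 1) (hq2 : ∀ i j, q i j * q j i = 1)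
    {y : QCI k c q a} (hy : y ≠ 0) :
    ∃ (r : QCI k c q a) (u : k), u ≠ 0 ∧ r * y = u • qciMonomial k q a (qciTop a) := by
  obtain ⟨l, hl, rfl⟩ := (Finsupp.mem_span_image_iff_linearCombination k).1
    (mem_span_qciMonomial hq1 hq2 y)
  have hne : l.support.Nonempty := by
    rw [Finsupp.support_nonempty_iff]
    rintro rfl
    exact hy (map_zero _)
  obtain ⟨m, hm⟩ := l.support.exists_minimal hne
  have hmT : m ≤ qciTop a := hl hm.1
  obtain ⟨u, hu, h⟩ := exists_qciMonomial_mul (a := a) hq1 hq2 (qciTop a - m) m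
  rw [tsub_add_cancel_of_le hmT] at h
  refine ⟨qciMonomial k q a (qciTop a - m), l m * u,
    mul_ne_zero (Finsupp.mem_support_iff.1 hm.1) hu, ?_⟩
  rw [Finsupp.linearCombination_apply, Finsupp.sum, Finset.mul_sum,
    Finset.sum_eq_single_of_mem m hm.1, mul_smul_comm, h, smul_smul]
  intro s hs hsm
  obtain ⟨v, -, h'⟩ := exists_qciMonomial_mul (a := a) hq1 hq2 (qciTop a - m) s
  rw [mul_smul_comm, h', qciMonomial_eq_zero_of_not_le hq1 hq2, smul_zero, smul_zero]
  intro hle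
  have hsm' : s ≤ m := by
    rw [← tsub_add_cancel_of_le hmT] at hle
    rwa [add_tsub_cancel_right, add_le_add_iff_left] at hle
  exact hsm (le_antisymm hsm' (hm.2 hs hsm'))

variable (q) in
/-- The scalar picked up when `x_i` is moved to its place in the increasing monomial with
factors `s`. -/
def qciCoeff (i : Fin c) (s : Multiset (Fin c)) : k :=
  (s.map fun j => if j < i then q i j else 1).prod

theorem qciCoeff_eq_mul_erase {i j : Fin c} {s : Multiset (Fin c)} (h : j ∈ s) :
    qciCoeff q i s = (if j < i then q i j else 1) * qciCoeff q i (s.erase j) := by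
  conv_lhs => rw [← Multiset.cons_erase h, qciCoeff, Multiset.map_cons, Multiset.prod_cons]
  rfl

theorem qciCoeff_ne_zero (hq2 : ∀ i j, q i j * q j i = 1) (i : Fin c) (s : Multiset (Fin c)) :
    qciCoeff q i s ≠ 0 := by
  refine Multiset.prod_ne_zero fun h => ?_
  obtain ⟨j, -, hj⟩ := Multiset.mem_map.1 h
  split_ifs at hj
  · exact left_ne_zero_of_mul_eq_one (hq2 i j) hj
  · exact one_ne_zero hj

variable (q a) in
/-- The action of `x_i` on coefficient functions of increasing monomials. -/
def qciShift (i : Fin c) : Module.End k (Multiset (Fin c) → k) where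
  toFun f s := if i ∈ s ∧ s.count i < a i then qciCoeff q i (s.erase i) * f (s.erase i) else 0
  map_add' f g := by
    ext s
    simp only [Pi.add_apply]
    split_ifs <;> ring
  map_smul' r f := by
    ext s
    simp only [Pi.smul_apply, smul_eq_mul, RingHom.id_apply]
    split_ifs <;> ring

theorem qciShift_apply (i : Fin c) (f : Multiset (Fin c) → k) (s : Multiset (Fin c)) :
    qciShift q a i f s =
      if i ∈ s ∧ s.count i < a i then qciCoeff q i (s.erase i) * f (s.erase i) else 0 := rfl

theorem qciShift_pow_apply_eq_zero (i : Fin c) (f : Multiset (Fin c) → k) (n : ℕ)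
    (s : Multiset (Fin c)) (h : s.count i < n) : (qciShift q a i ^ n) f s = 0 := by
  induction n generalizing s with
  | zero => omega
  | succ n ih =>
    rw [pow_succ', Module.End.mul_apply, qciShift_apply]
    split_ifs with hs
    · rw [ih, mul_zero]
      have := Multiset.count_pos.2 hs.1
      rw [Multiset.count_erase_self]
      omega
    · rfl

theorem qciShift_pow (i : Fin c) (hi : a i ≠ 0) : qciShift q a i ^ a i = 0 := by
  ext f s
  simp only [LinearMap.zero_apply, Pi.zero_apply]
  by_cases h : s.count i < a i
  · exact qciShift_pow_apply_eq_zero i f (a i) s h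
  · obtain ⟨n, hn⟩ := Nat.exists_eq_succ_of_ne_zero hi
    rw [hn, Nat.succ_eq_add_one, pow_succ', Module.End.mul_apply, qciShift_apply,
      if_neg fun h' => h h'.2]

theorem qciShift_mul (hq2 : ∀ i j, q i j * q j i = 1) {i j : Fin c} (hij : i < j) :
    qciShift q a i * qciShift q a j = q i j • (qciShift q a j * qciShift q a i) := by
  refine LinearMap.ext fun f => funext fun s => ?_
  simp only [Module.End.mul_apply, LinearMap.smul_apply, Pi.smul_apply, smul_eq_mul,
    qciShift_apply, Multiset.mem_erase_of_ne hij.ne, Multiset.mem_erase_of_ne hij.ne',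
    Multiset.count_erase_of_ne hij.ne, Multiset.count_erase_of_ne hij.ne']
  by_cases hi : i ∈ s ∧ s.count i < a i
  · by_cases hj : j ∈ s ∧ s.count j < a j
    · rw [if_pos hi, if_pos hj, if_pos hj, if_pos hi,
        qciCoeff_eq_mul_erase (i := i) ((Multiset.mem_erase_of_ne hij.ne').2 hj.1),
        qciCoeff_eq_mul_erase (i := j) ((Multiset.mem_erase_of_ne hij.ne).2 hi.1),
        if_neg hij.not_gt, if_pos hij, Multiset.erase_comm s j i]
      linear_combination (-(qciCoeff q i ((s.erase i).erase j) *
        qciCoeff q j ((s.erase i).erase j) * f ((s.erase i).erase j))) * hq2 i j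
    · simp [hj]
  · simp [hi]

variable (q a) in
/-- The algebra acts on coefficient functions of increasing monomials. -/
def qciAction (hq2 : ∀ i j, q i j * q j i = 1) (ha : ∀ i, a i ≠ 0) :
    QCI k c q a →ₐ[k] Module.End k (Multiset (Fin c) → k) :=
  RingQuot.liftAlgHom k ⟨FreeAlgebra.lift k (qciShift q a), fun x y h => by
    cases h with
    | pow i => rw [map_pow, FreeAlgebra.lift_ι_apply, qciShift_pow i (ha i), map_zero]
    | comm i j hij =>
      rw [map_mul, map_smul, map_mul, FreeAlgebra.lift_ι_apply, FreeAlgebra.lift_ι_apply,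
        qciShift_mul hq2 hij]⟩

theorem qciAction_Xgen (hq2 : ∀ i j, q i j * q j i = 1) (ha : ∀ i, a i ≠ 0) (i : Fin c) :
    qciAction q a hq2 ha (Xgen k c q a i) = qciShift q a i := by
  rw [qciAction, Xgen, RingQuot.liftAlgHom_mkAlgHom_apply, FreeAlgebra.lift_ι_apply]

theorem prod_qciShift_apply_ne_zero (hq2 : ∀ i j, q i j * q j i = 1) (l : List (Fin c))
    (h : ∀ i, l.count i < a i) :
    (l.map (qciShift q a)).prod (Pi.single 0 1) (l : Multiset (Fin c)) ≠ 0 := by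
  induction l with
  | nil => simp
  | cons i l ih =>
    have hi := h i
    rw [List.map_cons, List.prod_cons, Module.End.mul_apply, qciShift_apply,
      if_pos ⟨by simp, by simpa using hi⟩, ← Multiset.cons_coe, Multiset.erase_cons_head]
    exact mul_ne_zero (qciCoeff_ne_zero hq2 i _)
      (ih fun j => (List.count_le_count_cons).trans_lt (h j))

theorem qciMonomial_qciTop_ne_zero (hq2 : ∀ i j, q i j * q j i = 1) (ha : ∀ i, a i ≠ 0) :
    qciMonomial k q a (qciTop a) ≠ 0 := by
  intro h
  refine prod_qciShift_apply_ne_zero (a := a) hq2 (qciTop a).toList (fun i => ?_) ?_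
  · rw [← Multiset.coe_count, Multiset.coe_toList, count_qciTop]
    have := ha i
    omega
  · have h' := congrArg (qciAction q a hq2 ha) h
    rw [qciMonomial, map_list_prod, List.map_map, map_zero] at h'
    have hcomp : ⇑(qciAction q a hq2 ha) ∘ Xgen k c q a = qciShift q a :=
      funext (qciAction_Xgen hq2 ha)
    rw [hcomp] at h'
    rw [h']
    rfl

end QCI

/-- the quantum complete intersection `A` is selfinjective, i.e. `A` is
injective as a left module over itself. -/
theorem statement1 (k : Type) [Field k] (c : ℕ) (hc : 1 ≤ c)
    (q : Fin c → Fin c → k) (hq1 : ∀ i, q i i = 1) (hq2 : ∀ i j, q i j * q j i = 1)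
    (a : Fin c → ℕ) (ha : ∀ i, 2 ≤ a i) :
    Module.Injective (QCI k c q a) (QCI k c q a) := by
  have hT : qciMonomial k q a (qciTop a) ≠ 0 :=
    qciMonomial_qciTop_ne_zero hq2 fun i => by have := ha i; omega
  have := finiteDimensional_qci (a := a) hq1 hq2
  obtain ⟨φ, hφ⟩ : ∃ φ : Module.Dual k (QCI k c q a), φ (qciMonomial k q a (qciTop a)) ≠ 0 := by
    by_contra! h
    exact hT ((Module.forall_dual_apply_eq_zero_iff k _).1 h)
  refine injective_self_of_nondegenerate_form φ fun y hy => ?_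
  by_contra hne
  obtain ⟨r, u, hu, h⟩ := exists_mul_eq_smul_qciTop hq1 hq2 hne
  have h' := hy r
  rw [h, map_smul, smul_eq_mul] at h'
  exact mul_ne_zero hu hφ h'
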